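/- Let G₂ be a refinement of a finite connected weighted graph G₁. Then the refinement homomorphism induces an injective group homomorphism ρ: J(G₁) → J(G₂) between the Jacobian groups, and for a chain of refinements G₁ ≤ G₂ ≤ G₃ these injections are compatible: ρ₃₁ = ρ₃₂ ∘ ρ₂₁. -/

import Mathlib

/-- A finite weighted (multi)graph with a fixed orientation of the edges:
vertex type `V`, edge type `E`, tail/head maps and a positive length function. -/
structure WGraph where
  V : Type
  E : Type
  [fV : Fintype V]
  [fE : Fintype E]
  [dV : DecidableEq V]
  [dE : DecidableEq E]
  tail : E → V
  head : E → V
  len : E → ℝ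
  len_pos : ∀ e, 0 < len e

attribute [instance] WGraph.fV WGraph.fE WGraph.dV WGraph.dE

namespace WGraph

variable (G : WGraph)

/-- Two vertices are adjacent if some edge joins them (in either direction). -/
def Adj (x y : G.V) : Prop :=
  ∃ e, (G.tail e = x ∧ G.head e = y) ∨ (G.tail e = y ∧ G.head e = x)

/-- A weighted graph is connected if any two vertices are joined by a walk. -/
def Connected : Prop := ∀ x y : G.V, Relation.ReflTransGen G.Adj x y

/-- The differential `d : C_0(G,ℝ) → C_1(G,ℝ)`, `(df)(e) = (f(e⁺) - f(e⁻))/ℓ(e)`. -/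
noncomputable def d (f : G.V → ℝ) : G.E → ℝ :=
  fun e => (f (G.head e) - f (G.tail e)) / G.len e

/-- The adjoint `d* : C_1(G,ℝ) → C_0(G,ℝ)`,
`(d*α)(x) = Σ_{e⁺ = x} α(e) - Σ_{e⁻ = x} α(e)`. -/
def dStar (α : G.E → ℝ) : G.V → ℝ := fun x =>
  (∑ e ∈ Finset.univ.filter fun e => G.head e = x, α e) -
    ∑ e ∈ Finset.univ.filter fun e => G.tail e = x, α e

/-- The inner product `⟨α,β⟩ = Σ_e α(e) β(e) ℓ(e)` on real 1-chains. -/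
noncomputable def ip (α β : G.E → ℝ) : ℝ := ∑ e, α e * β e * G.len e

/-- Real 1-cycles: the kernel of `d*`. -/
def IsCycle (α : G.E → ℝ) : Prop := ∀ x, G.dStar α x = 0

/-- Exact 1-chains: the image of `d`. -/
def IsExact (α : G.E → ℝ) : Prop := ∃ f : G.V → ℝ, α = G.d f

/-- A 1-form `ω = Σ ω_e de` (recorded by its coefficients) is harmonic if at every
vertex the incoming and outgoing coefficients sum to the same value. -/
def Harmonic (ω : G.E → ℝ) : Prop :=
  ∀ x, (∑ e ∈ Finset.univ.filter fun e => G.head e = x, ω e) =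
    ∑ e ∈ Finset.univ.filter fun e => G.tail e = x, ω e

/-- Integration of the 1-form `ω` along the 1-chain `α`: `∫_α ω = Σ_e ω_e α(e) ℓ(e)`. -/
noncomputable def intPair (ω α : G.E → ℝ) : ℝ := ∑ e, ω e * α e * G.len e

/-- `d*` on integral 1-chains. -/
def dStarZ (α : G.E → ℤ) : G.V → ℤ := fun x =>
  (∑ e ∈ Finset.univ.filter fun e => G.head e = x, α e) -
    ∑ e ∈ Finset.univ.filter fun e => G.tail e = x, α e

/-- Integral 1-cycles. -/
def IsCycleZ (α : G.E → ℤ) : Prop := ∀ x, G.dStarZ α x = 0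

/-- `α ∈ im(d)_ℤ`: `α` is an integral 1-chain which is the differential of a real
function on the vertices (a function with integer slopes). -/
def IsExactZ (α : G.E → ℤ) : Prop :=
  ∃ f : G.V → ℝ, ∀ e, (α e : ℝ) = G.d f e

/-- The subgroup `H_1(G,ℤ) ⊕ im(d)_ℤ` of `C_1(G,ℤ)`, i.e. the subgroup generated by
integral cycles together with integral exact chains. -/
def jacRel : AddSubgroup (G.E → ℤ) :=
  AddSubgroup.closure {α | G.IsCycleZ α ∨ G.IsExactZ α}

/-- The Jacobian group of a weighted graph: `J(G) = C_1(G,ℤ)/(H_1(G,ℤ) ⊕ im(d)_ℤ)`. -/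
def Jac := (G.E → ℤ) ⧸ G.jacRel

noncomputable instance : AddCommGroup G.Jac :=
  inferInstanceAs (AddCommGroup ((G.E → ℤ) ⧸ G.jacRel))

/-- Divisors of degree zero. -/
def Div0 : AddSubgroup (G.V → ℤ) where
  carrier := {D | ∑ x, D x = 0}
  add_mem' := by
    intro a b ha hb
    simp only [Set.mem_setOf_eq] at *
    simp [Finset.sum_add_distrib, ha, hb]
  zero_mem' := by simp
  neg_mem' := by
    intro a ha
    simp only [Set.mem_setOf_eq] at *
    simp [ha]

/-- `d*` as a group homomorphism on integral 1-chains. -/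
def dStarZHom : (G.E → ℤ) →+ (G.V → ℤ) where
  toFun := G.dStarZ
  map_zero' := by funext x; simp [dStarZ]
  map_add' := by
    intro a b
    funext x
    simp [dStarZ, Finset.sum_add_distrib]
    ring

/-- The subgroup `im(d)_ℤ` of `C_1(G,ℤ)`. -/
def imdZ : AddSubgroup (G.E → ℤ) where
  carrier := {α | G.IsExactZ α}
  add_mem' := by
    rintro a b ⟨f, hf⟩ ⟨g, hg⟩
    exact ⟨f + g, fun e => by
      simp only [Pi.add_apply, Int.cast_add, hf e, hg e, d]; ring⟩
  zero_mem' := ⟨0, fun e => by simp [d]⟩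
  neg_mem' := by
    rintro a ⟨f, hf⟩
    exact ⟨-f, fun e => by
      simp only [Pi.neg_apply, Int.cast_neg, hf e, d]; ring⟩

/-- Principal divisors: `Prin(G) = d*(im(d)_ℤ)`. -/
def Prin : AddSubgroup (G.V → ℤ) := G.imdZ.map G.dStarZHom

lemma sum_dStarZ (α : G.E → ℤ) : ∑ x, G.dStarZ α x = 0 := by
  simp only [dStarZ, Finset.sum_sub_distrib]
  rw [Finset.sum_fiberwise, Finset.sum_fiberwise]
  simp

/-- The degree-zero Picard group `Pic(G) = Div⁰(G)/Prin(G)`. -/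
def PicZ := G.Div0 ⧸ (G.Prin.addSubgroupOf G.Div0)

noncomputable instance : AddCommGroup G.PicZ :=
  inferInstanceAs (AddCommGroup (G.Div0 ⧸ (G.Prin.addSubgroupOf G.Div0)))

/-- The weighted graph obtained by deleting the edge `e₀`. -/
def delEdge (e₀ : G.E) : WGraph where
  V := G.V
  E := {e : G.E // e ≠ e₀}
  tail := fun e => G.tail e.1
  head := fun e => G.head e.1
  len := fun e => G.len e.1
  len_pos := fun e => G.len_pos e.1

/-- An edge is a bridge if deleting it disconnects the graph. -/
def IsBridge (e₀ : G.E) : Prop := ¬ (G.delEdge e₀).Connected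

/-- The weighted graph obtained by deleting a vertex `z` (and all incident edges). -/
def delVertex (z : G.V) : WGraph where
  V := {x : G.V // x ≠ z}
  E := {e : G.E // G.tail e ≠ z ∧ G.head e ≠ z}
  tail := fun e => ⟨G.tail e.1, e.2.1⟩
  head := fun e => ⟨G.head e.1, e.2.2⟩
  len := fun e => G.len e.1
  len_pos := fun e => G.len_pos e.1

open scoped Classical in
/-- The (discrete) potential kernel: `jKer z y` is the function `f` with `f(z) = 0`
and `Δf = δ_y - δ_z` (when such a function exists; it is unique on a
connected graph). -/
noncomputable def jKer (z y : G.V) : G.V → ℝ :=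
  if h : ∃ f : G.V → ℝ, f z = 0 ∧ ∀ w, G.dStar (G.d f) w =
      (if w = y then 1 else 0) - (if w = z then 1 else 0)
  then h.choose else 0

/-- Connectivity using only the edges in `S`. -/
def ConnectedOn (S : Finset G.E) : Prop :=
  ∀ x y : G.V, Relation.ReflTransGen
    (fun a b => ∃ e ∈ S, (G.tail e = a ∧ G.head e = b) ∨ (G.tail e = b ∧ G.head e = a)) x y

/-- A spanning tree: a spanning connected edge set with `#V - 1` edges. -/
def IsSpanningTree (T : Finset G.E) : Prop :=
  G.ConnectedOn T ∧ T.card + 1 = Fintype.card G.V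

/-- The weight `w(T) = Π_{e ∉ T} ℓ(e)` of a spanning tree. -/
noncomputable def wt (T : Finset G.E) : ℝ := ∏ e ∈ Finset.univ \ T, G.len e

open scoped Classical in
/-- `w(G) = Σ_T w(T)`, summed over all spanning trees. -/
noncomputable def wG : ℝ := ∑ T : Finset G.E, if G.IsSpanningTree T then G.wt T else 0

open scoped Classical in
/-- The Foster coefficient `F(e) = (1/w(G)) Σ_{T : e ∉ T} w(T)`. -/
noncomputable def foster (e : G.E) : ℝ :=
  (1 / G.wG) * ∑ T : Finset G.E, if G.IsSpanningTree T ∧ e ∉ T then G.wt T else 0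

open scoped Classical in
/-- The fundamental cycle `α_{T,e}`: the unique 1-cycle supported on `T ∪ {e}` taking
the value `1` on `e`; by convention it is `0` when no such cycle exists
(e.g. when `e ∈ T`). -/
noncomputable def fundCycle (T : Finset G.E) (e : G.E) : G.E → ℝ :=
  if h : ∃ α : G.E → ℝ, G.IsCycle α ∧ α e = 1 ∧ ∀ f, f ∉ T → f ≠ e → α f = 0
  then h.choose else 0

end WGraph

namespace WGraph

/-- A refinement of `G₁`: the graph `G₂` is obtained from `G₁` by subdividing each
edge `e` into `n e` consecutive edges, in a length-preserving and
orientation-compatible manner. -/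
structure Refinement (G₁ G₂ : WGraph) where
  /-- the injection on vertices -/
  a : G₁.V → G₂.V
  ainj : Function.Injective a
  /-- the surjection on edges, sending a subdivision edge to the edge it subdivides -/
  b : G₂.E → G₁.E
  /-- the number of subdivision edges of each edge -/
  n : G₁.E → ℕ
  npos : ∀ e, 0 < n e
  /-- the vertices along the subdivision of `e` -/
  vtx : (e : G₁.E) → Fin (n e + 1) → G₂.V
  /-- the subdivision edges of `e`, in order -/
  ed : (e : G₁.E) → Fin (n e) → G₂.E
  /-- every edge of `G₂` is a subdivision edge of exactly one edge of `G₁`, exactly once -/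
  ed_bij : Function.Bijective (fun p : Σ e : G₁.E, Fin (n e) => ed p.1 p.2)
  b_ed : ∀ e i, b (ed e i) = e
  /-- subdividing preserves lengths -/
  len_sum : ∀ e, ∑ i, G₂.len (ed e i) = G₁.len e
  vtx_zero : ∀ e, vtx e 0 = a (G₁.tail e)
  vtx_last : ∀ e, vtx e (Fin.last (n e)) = a (G₁.head e)
  tail_ed : ∀ e i, G₂.tail (ed e i) = vtx e i.castSucc
  head_ed : ∀ e i, G₂.head (ed e i) = vtx e i.succ
  /-- interior subdivision vertices are new vertices -/
  vtx_fresh : ∀ e (i : Fin (n e + 1)), i ≠ 0 → i ≠ Fin.last (n e) → ∀ x, vtx e i ≠ a x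
  /-- interior subdivision vertices of (possibly different) edges are pairwise distinct -/
  vtx_inj : ∀ e e' (i : Fin (n e + 1)) (i' : Fin (n e' + 1)),
    i ≠ 0 → i ≠ Fin.last (n e) → i' ≠ 0 → i' ≠ Fin.last (n e') →
    vtx e i = vtx e' i' → e = e' ∧ (i : ℕ) = (i' : ℕ)
  /-- every vertex of `G₂` is an old vertex or an interior subdivision vertex -/
  vtx_surj : ∀ v : G₂.V, (∃ x, v = a x) ∨ ∃ e i, v = vtx e i

/-- The refinement homomorphism `r : C_1(G₁,A) → C_1(G₂,A)` sending each edge to the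
sum of its subdivision edges; as a function on edges, `r(α)(e') = α(b(e'))`. -/
def Refinement.r {G₁ G₂ : WGraph} (R : Refinement G₁ G₂) {A : Type*} (α : G₁.E → A) :
    G₂.E → A := fun e' => α (R.b e')

end WGraph

namespace WGraph

lemma mem_jacRel_iff (G : WGraph) (α : G.E → ℤ) :
    α ∈ G.jacRel ↔ ∃ c, G.IsCycleZ c ∧ ∃ β, G.IsExactZ β ∧ c + β = α := by
  constructor
  · intro h
    have hle : G.jacRel ≤ G.dStarZHom.ker ⊔ G.imdZ := by
      refine (AddSubgroup.closure_le _).2 ?_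
      rintro β (hβ | hβ)
      · exact AddSubgroup.mem_sup_left (AddMonoidHom.mem_ker.2 (funext hβ))
      · exact AddSubgroup.mem_sup_right hβ
    obtain ⟨c, hc, β, hβ, hsum⟩ := AddSubgroup.mem_sup.1 (hle h)
    exact ⟨c, fun x => congrFun (AddMonoidHom.mem_ker.1 hc) x, β, hβ, hsum⟩
  · rintro ⟨c, hc, β, hβ, rfl⟩
    exact G.jacRel.add_mem (AddSubgroup.subset_closure (Or.inl hc))
      (AddSubgroup.subset_closure (Or.inr hβ))

lemma dStarZ_eq_sum (G : WGraph) (α : G.E → ℤ) (x : G.V) :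
    G.dStarZ α x =
      ∑ e, α e * ((if G.head e = x then 1 else 0) - if G.tail e = x then 1 else 0) := by
  simp [dStarZ, Finset.sum_filter, mul_sub]

namespace Refinement

variable {G₁ G₂ : WGraph} (R : Refinement G₁ G₂)

/-- The refinement map as a homomorphism on integral 1-chains. -/
def rHom : (G₁.E → ℤ) →+ (G₂.E → ℤ) where
  toFun := R.r
  map_zero' := rfl
  map_add' _ _ := rfl

lemma sum_edges {A : Type*} [AddCommMonoid A] (g : G₂.E → A) :
    ∑ e', g e' = ∑ e, ∑ i, g (R.ed e i) := by
  rw [← Equiv.sum_comp (Equiv.ofBijective _ R.ed_bij), Fintype.sum_sigma]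
  rfl

lemma exists_ed (e' : G₂.E) : ∃ e i, R.ed e i = e' := by
  obtain ⟨⟨e, i⟩, h⟩ := R.ed_bij.surjective e'
  exact ⟨e, i, h⟩

lemma dStarZ_r (c : G₁.E → ℤ) (v : G₂.V) :
    G₂.dStarZ (R.r c) v =
      ∑ e, c e * ((if R.a (G₁.head e) = v then 1 else 0) -
        if R.a (G₁.tail e) = v then 1 else 0) := by
  rw [dStarZ_eq_sum, R.sum_edges]
  refine Finset.sum_congr rfl fun e _ => ?_
  simp only [r, R.b_ed, R.head_ed, R.tail_ed, ← Finset.mul_sum, Finset.sum_sub_distrib]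
  congr 1
  have h₁ := Fin.sum_univ_succ fun i => if R.vtx e i = v then (1 : ℤ) else 0
  have h₂ := Fin.sum_univ_castSucc fun i => if R.vtx e i = v then (1 : ℤ) else 0
  simp only [R.vtx_zero, R.vtx_last] at h₁ h₂
  linarith

lemma dStarZ_r_a (c : G₁.E → ℤ) (x : G₁.V) : G₂.dStarZ (R.r c) (R.a x) = G₁.dStarZ c x := by
  rw [dStarZ_r, dStarZ_eq_sum]
  simp only [R.ainj.eq_iff]

lemma isCycleZ_r_iff (c : G₁.E → ℤ) : G₂.IsCycleZ (R.r c) ↔ G₁.IsCycleZ c := by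
  refine ⟨fun h x => by rw [← R.dStarZ_r_a, h], fun h v => ?_⟩
  by_cases hv : ∃ x, R.a x = v
  · obtain ⟨x, rfl⟩ := hv
    rw [R.dStarZ_r_a, h]
  · push Not at hv
    simp [dStarZ_r, hv]

lemma eq_of_vtx_eq {e e' : G₁.E} {i : Fin (R.n e + 1)} {i' : Fin (R.n e' + 1)}
    (h0 : i ≠ 0) (hl : i ≠ Fin.last _) (h : R.vtx e i = R.vtx e' i') :
    e = e' ∧ (i : ℕ) = i' := by
  refine R.vtx_inj e e' i i' h0 hl ?_ ?_ h
  · rintro rfl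
    exact R.vtx_fresh e i h0 hl _ (h.trans (R.vtx_zero e'))
  · rintro rfl
    exact R.vtx_fresh e i h0 hl _ (h.trans (R.vtx_last e'))

lemma cycle_consecutive {c : G₂.E → ℤ} (hc : G₂.IsCycleZ c) (e : G₁.E) (k : ℕ)
    (hk : k + 1 < R.n e) :
    c (R.ed e ⟨k + 1, hk⟩) = c (R.ed e ⟨k, by omega⟩) := by
  have h0 : (⟨k + 1, by omega⟩ : Fin (R.n e + 1)) ≠ 0 := by simp [Fin.ext_iff]
  have hl : (⟨k + 1, by omega⟩ : Fin (R.n e + 1)) ≠ Fin.last _ := by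
    simp [Fin.ext_iff, hk.ne]
  have hhead : (Finset.univ.filter fun e' => G₂.head e' = R.vtx e ⟨k + 1, by omega⟩) =
      {R.ed e ⟨k, by omega⟩} := by
    ext e'
    simp only [Finset.mem_filter, Finset.mem_univ, true_and, Finset.mem_singleton]
    constructor
    · obtain ⟨e₁, i, rfl⟩ := R.exists_ed e'
      intro h
      rw [R.head_ed] at h
      obtain ⟨rfl, hi⟩ := R.eq_of_vtx_eq h0 hl h.symm
      congr 1
      ext
      simp at hi
      exact hi.symm
    · rintro rfl
      exact R.head_ed _ _
  have htail : (Finset.univ.filter fun e' => G₂.tail e' = R.vtx e ⟨k + 1, by omega⟩) =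
      {R.ed e ⟨k + 1, hk⟩} := by
    ext e'
    simp only [Finset.mem_filter, Finset.mem_univ, true_and, Finset.mem_singleton]
    constructor
    · obtain ⟨e₁, i, rfl⟩ := R.exists_ed e'
      intro h
      rw [R.tail_ed] at h
      obtain ⟨rfl, hi⟩ := R.eq_of_vtx_eq h0 hl h.symm
      congr 1
      ext
      exact hi.symm
    · rintro rfl
      exact R.tail_ed _ _
  have h := hc (R.vtx e ⟨k + 1, by omega⟩)
  rw [dStarZ, hhead, htail, Finset.sum_singleton, Finset.sum_singleton] at h
  linarith

lemma exists_r_eq_of_isCycleZ {c : G₂.E → ℤ} (hc : G₂.IsCycleZ c) : ∃ c', R.r c' = c := by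
  have key : ∀ e k (hk : k < R.n e), c (R.ed e ⟨k, hk⟩) = c (R.ed e ⟨0, R.npos e⟩) := by
    intro e k
    induction k with
    | zero => intro _; rfl
    | succ k ih =>
      intro hk
      rw [R.cycle_consecutive hc e k hk, ih]
  refine ⟨fun e => c (R.ed e ⟨0, R.npos e⟩), funext fun e' => ?_⟩
  obtain ⟨e, i, rfl⟩ := R.exists_ed e'
  rw [r, R.b_ed]
  exact (key e i i.2).symm

lemma isExactZ_of_r {α : G₁.E → ℤ} (h : G₂.IsExactZ (R.r α)) : G₁.IsExactZ α := by
  obtain ⟨f, hf⟩ := h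
  refine ⟨f ∘ R.a, fun e => ?_⟩
  have hstep : ∀ i, (α e : ℝ) * G₂.len (R.ed e i) =
      f (R.vtx e i.succ) - f (R.vtx e i.castSucc) := by
    intro i
    have h := hf (R.ed e i)
    rw [d, R.head_ed, R.tail_ed, eq_div_iff (G₂.len_pos _).ne', r, R.b_ed] at h
    exact h
  rw [d, eq_div_iff (G₁.len_pos _).ne', ← R.len_sum, Finset.mul_sum,
    Finset.sum_congr rfl fun i _ => hstep i, Finset.sum_sub_distrib]
  have h₁ := Fin.sum_univ_succ fun i => f (R.vtx e i)
  have h₂ := Fin.sum_univ_castSucc fun i => f (R.vtx e i)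
  simp only [R.vtx_zero, R.vtx_last] at h₁ h₂
  simp only [Function.comp]
  linarith

lemma exists_extension (f : G₁.V → ℝ) (g : (e : G₁.E) → Fin (R.n e + 1) → ℝ)
    (hg0 : ∀ e, g e 0 = f (G₁.tail e)) (hgl : ∀ e, g e (Fin.last _) = f (G₁.head e)) :
    ∃ F : G₂.V → ℝ, ∀ e i, F (R.vtx e i) = g e i := by
  have hold : ∀ x e i, R.a x = R.vtx e i → f x = g e i := by
    intro x e i h
    by_cases h0 : i = 0
    · subst h0
      rw [R.vtx_zero] at h
      rw [hg0, R.ainj h]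
    by_cases hl : i = Fin.last _
    · subst hl
      rw [R.vtx_last] at h
      rw [hgl, R.ainj h]
    exact absurd h.symm (R.vtx_fresh e i h0 hl x)
  have hex : ∀ v, ∃ t, ∀ e i, v = R.vtx e i → t = g e i := by
    intro v
    by_cases hv : ∃ x, v = R.a x
    · obtain ⟨x, rfl⟩ := hv
      exact ⟨f x, hold x⟩
    obtain ⟨e, i, rfl⟩ := (R.vtx_surj v).resolve_left hv
    refine ⟨g e i, fun e' i' h => ?_⟩
    have h0 : i ≠ 0 := by
      rintro rfl
      exact hv ⟨_, R.vtx_zero e⟩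
    have hl : i ≠ Fin.last _ := by
      rintro rfl
      exact hv ⟨_, R.vtx_last e⟩
    obtain ⟨rfl, hi⟩ := R.eq_of_vtx_eq h0 hl h
    rw [Fin.ext hi]
  choose F hF using hex
  exact ⟨F, fun e i => hF _ e i rfl⟩

lemma isExactZ_r {α : G₁.E → ℤ} (h : G₁.IsExactZ α) : G₂.IsExactZ (R.r α) := by
  obtain ⟨f, hf⟩ := h
  obtain ⟨F, hF⟩ := R.exists_extension f
    (fun e i => f (G₁.tail e) +
      α e * Fin.partialSum (fun j => G₂.len (R.ed e j)) i)
    (fun e => by simp)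
    (fun e => by
      have h := hf e
      rw [d, eq_div_iff (G₁.len_pos _).ne', ← R.len_sum] at h
      have hlast : Fin.partialSum (fun j => G₂.len (R.ed e j)) (Fin.last (R.n e)) =
          ∑ j, G₂.len (R.ed e j) := by
        rw [Fin.partialSum, Fin.val_last, List.take_of_length_le (by simp), List.sum_ofFn]
      rw [hlast, h]
      ring)
  refine ⟨F, fun e' => ?_⟩
  obtain ⟨e, i, rfl⟩ := R.exists_ed e'
  rw [d, R.head_ed, R.tail_ed, hF, hF, eq_div_iff (G₂.len_pos _).ne', r, R.b_ed,
    Fin.partialSum_succ]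
  ring

lemma r_mem_jacRel_iff (α : G₁.E → ℤ) : R.r α ∈ G₂.jacRel ↔ α ∈ G₁.jacRel := by
  rw [mem_jacRel_iff, mem_jacRel_iff]
  constructor
  · rintro ⟨c, hc, β, hβ, hsum⟩
    obtain ⟨c', rfl⟩ := R.exists_r_eq_of_isCycleZ hc
    refine ⟨c', (R.isCycleZ_r_iff c').1 hc, α - c', R.isExactZ_of_r ?_, by abel⟩
    have hβ' : R.r (α - c') = β := by
      rw [eq_comm, eq_sub_of_add_eq' hsum]
      rfl
    rwa [hβ']
  · rintro ⟨c, hc, β, hβ, rfl⟩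
    exact ⟨R.r c, (R.isCycleZ_r_iff c).2 hc, R.r β, R.isExactZ_r hβ, rfl⟩

/-- The homomorphism of Jacobians induced by a refinement. -/
noncomputable def jacHom : G₁.Jac →+ G₂.Jac :=
  QuotientAddGroup.map G₁.jacRel G₂.jacRel R.rHom fun α hα => (R.r_mem_jacRel_iff α).2 hα

lemma jacHom_injective : Function.Injective R.jacHom := by
  refine (injective_iff_map_eq_zero _).2 fun q => ?_
  induction q using QuotientAddGroup.induction_on with
  | H α =>
    intro h
    exact (QuotientAddGroup.eq_zero_iff α).2
      ((R.r_mem_jacRel_iff α).1 ((QuotientAddGroup.eq_zero_iff (R.r α)).1 h))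

end Refinement

end WGraph

/-- A refinement induces an injective homomorphism
`ρ : J(G₁) → J(G₂)` of Jacobians (compatible with the refinement map on integral
1-chains), and for a chain of refinements `G₁ ≤ G₂ ≤ G₃` these maps compose:
`ρ₃₁ = ρ₃₂ ∘ ρ₂₁`. -/
theorem refinement_jacobian (G₁ G₂ : WGraph) (hG₁ : G₁.Connected) (hG₂ : G₂.Connected)
    (R : WGraph.Refinement G₁ G₂) :
    (∃ ρ : G₁.Jac →+ G₂.Jac, Function.Injective ρ ∧
      ∀ α : G₁.E → ℤ, ρ (QuotientAddGroup.mk α) = QuotientAddGroup.mk (R.r α)) ∧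
    (∀ (G₃ : WGraph) (S : WGraph.Refinement G₂ G₃) (T : WGraph.Refinement G₁ G₃),
      T.b = R.b ∘ S.b →
      ∀ (ρ₂₁ : G₁.Jac →+ G₂.Jac) (ρ₃₂ : G₂.Jac →+ G₃.Jac) (ρ₃₁ : G₁.Jac →+ G₃.Jac),
        (∀ α : G₁.E → ℤ, ρ₂₁ (QuotientAddGroup.mk α) = QuotientAddGroup.mk (R.r α)) →
        (∀ α : G₂.E → ℤ, ρ₃₂ (QuotientAddGroup.mk α) = QuotientAddGroup.mk (S.r α)) →
        (∀ α : G₁.E → ℤ, ρ₃₁ (QuotientAddGroup.mk α) = QuotientAddGroup.mk (T.r α)) →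
        ρ₃₁ = ρ₃₂.comp ρ₂₁) := by
  refine ⟨⟨R.jacHom, R.jacHom_injective, fun _ => rfl⟩, ?_⟩
  intro G₃ S T hT ρ₂₁ ρ₃₂ ρ₃₁ h₂₁ h₃₂ h₃₁
  refine DFunLike.ext _ _ fun q => ?_
  induction q using QuotientAddGroup.induction_on with
  | H α =>
    have hr : T.r α = S.r (R.r α) := by
      funext e
      exact congrArg α (congrFun hT e)
    exact (h₃₁ α).trans
      ((congrArg _ hr).trans ((h₃₂ _).symm.trans (congrArg ρ₃₂ (h₂₁ α).symm)))
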